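/- arXiv:1009.2990 — 3 statements merged into one kernel-verified Lean document; each statement's English description precedes it below -/
import Mathlib

section
/- (Palindromicity of the string functions.) For every N ≥ 0 and all integers a, b one has μ_N(a,b) = μ_N(a+S, b+S), where S = N²/4 + (a−b)² − 2a if N is even, and S = (N²−1)/4 + (a−b)² − (a−b) − 2b if N is odd. Equivalently, the multiplicities along each string {a − b = constant} (weights differing by a multiple of the null root δ) are symmetric: for even N the string with a−b = c is symmetric about the point a = N²/8 + c²/2, and for odd N it is symmetric about the point b = (N²−2)/8 + (c − 1/2)²/2. -/
/-- The image of the delta measure at `p` under the Demazure operator `D₀`, acting in the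
coordinates `λ = Λ₀ - a·α₀ - b·α₁`: `D₀ δ_{(a,b)} = ∑_{i=0}^{1-2a+2b} δ_{(a+i,b)}`, with the
signed-sum convention `∑_{i=0}^{-1} = 0` and `∑_{i=0}^{n} = -∑_{i=n+1}^{-1}` for `n ≤ -2`. -/
noncomputable def elemD0 (p : ℤ × ℤ) : (ℤ × ℤ) →₀ ℤ :=
  (∑ i ∈ Finset.Icc (0 : ℤ) (1 - 2 * p.1 + 2 * p.2), Finsupp.single (p.1 + i, p.2) (1 : ℤ))
  - (∑ i ∈ Finset.Icc (1 - 2 * p.1 + 2 * p.2 + 1) (-1 : ℤ), Finsupp.single (p.1 + i, p.2) (1 : ℤ))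

/-- The image of the delta measure at `p` under the Demazure operator `D₁`:
`D₁ δ_{(a,b)} = ∑_{i=0}^{2a-2b} δ_{(a,b+i)}`, with the signed-sum convention. -/
noncomputable def elemD1 (p : ℤ × ℤ) : (ℤ × ℤ) →₀ ℤ :=
  (∑ i ∈ Finset.Icc (0 : ℤ) (2 * p.1 - 2 * p.2), Finsupp.single (p.1, p.2 + i) (1 : ℤ))
  - (∑ i ∈ Finset.Icc (2 * p.1 - 2 * p.2 + 1) (-1 : ℤ), Finsupp.single (p.1, p.2 + i) (1 : ℤ))

/-- The Demazure operator `D₀` on finitely supported functions `ℤ × ℤ → ℤ`. -/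
noncomputable def demD0 (mu : (ℤ × ℤ) →₀ ℤ) : (ℤ × ℤ) →₀ ℤ :=
  mu.sum fun p c => c • elemD0 p

/-- The Demazure operator `D₁` on finitely supported functions `ℤ × ℤ → ℤ`. -/
noncomputable def demD1 (mu : (ℤ × ℤ) →₀ ℤ) : (ℤ × ℤ) →₀ ℤ :=
  mu.sum fun p c => c • elemD1 p

/-- The weight distribution `μ_N` of the Demazure module `V_{w_N}(Λ₀)` of affine sl₂,
where a weight is written `λ = Λ₀ - a·α₀ - b·α₁`:  `μ₀ = δ_{(0,0)}`,
`μ_{N+1} = D₀ μ_N` for even `N` and `μ_{N+1} = D₁ μ_N` for odd `N`. -/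
noncomputable def demMu : ℕ → (ℤ × ℤ) →₀ ℤ
  | 0 => Finsupp.single (0, 0) 1
  | (N + 1) => if Even N then demD0 (demMu N) else demD1 (demMu N)

/-- Total mass `∑_{(a,b)} μ(a,b)` of a finitely supported signed measure, in `ℚ`. -/
noncomputable def totalMass (mu : (ℤ × ℤ) →₀ ℤ) : ℚ :=
  mu.sum fun _ c => (c : ℚ)

/-- Expected value of `f` with respect to `μ`. -/
noncomputable def expVal (mu : (ℤ × ℤ) →₀ ℤ) (f : ℤ × ℤ → ℚ) : ℚ :=
  (mu.sum fun p c => (c : ℚ) * f p) / totalMass mu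

/-- Covariance of `f` and `g` with respect to `μ`. -/
noncomputable def covar (mu : (ℤ × ℤ) →₀ ℤ) (f g : ℤ × ℤ → ℚ) : ℚ :=
  expVal mu (fun p => f p * g p) - expVal mu f * expVal mu g

/-- Variance of `f` with respect to `μ`. -/
noncomputable def var (mu : (ℤ × ℤ) →₀ ℤ) (f : ℤ × ℤ → ℚ) : ℚ :=
  covar mu f f

/-- The coefficient of `q ^ d` in the Gaussian binomial coefficient `[n choose k]_q`. -/
def gaussCoeff : ℕ → ℤ → ℤ → ℤ
  | 0, k, d => if k = 0 ∧ d = 0 then 1 else 0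
  | n + 1, k, d => gaussCoeff n k d + gaussCoeff n (k - 1) (d - (n + 1 - k))

theorem gaussCoeff_succ (n : ℕ) (k d : ℤ) :
    gaussCoeff (n + 1) k d = gaussCoeff n k d + gaussCoeff n (k - 1) (d - (n + 1 - k)) := rfl

theorem gaussCoeff_succ' (n : ℕ) (k d : ℤ) :
    gaussCoeff (n + 1) k d = gaussCoeff n k (d - k) + gaussCoeff n (k - 1) d := by
  induction n generalizing k d with
  | zero =>
    simp only [gaussCoeff]
    push_cast
    grind
  | succ n ih =>
    rw [gaussCoeff_succ, ih, ih (k - 1), gaussCoeff_succ n k, gaussCoeff_succ n (k - 1)]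
    push_cast
    ring_nf

theorem gaussCoeff_symm (n : ℕ) (k d : ℤ) : gaussCoeff n (n - k) d = gaussCoeff n k d := by
  induction n generalizing k d with
  | zero => simp [gaussCoeff]
  | succ n ih =>
    rw [gaussCoeff_succ, gaussCoeff_succ', ← ih k, ← ih (k - 1)]
    push_cast
    ring_nf

theorem gaussCoeff_palindromic (n : ℕ) (k d : ℤ) :
    gaussCoeff n k (k * (n - k) - d) = gaussCoeff n k d := by
  induction n generalizing k d with
  | zero =>
    simp only [gaussCoeff]
    congr 1
    grind
  | succ n ih =>
    rw [gaussCoeff_succ, gaussCoeff_succ', ← ih k (d - k), ← ih (k - 1) d]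
    push_cast
    ring_nf

theorem gaussCoeff_eq_zero_of_neg (n : ℕ) {k : ℤ} (hk : k < 0) (d : ℤ) :
    gaussCoeff n k d = 0 := by
  induction n generalizing k d with
  | zero => simp [gaussCoeff, hk.ne]
  | succ n ih => rw [gaussCoeff_succ, ih hk, ih (by lia), add_zero]

theorem gaussCoeff_eq_zero_of_lt (n : ℕ) {k : ℤ} (hk : n < k) (d : ℤ) :
    gaussCoeff n k d = 0 := by
  rw [← gaussCoeff_symm, gaussCoeff_eq_zero_of_neg n (by lia)]

theorem elemD0_apply (p : ℤ × ℤ) (a b : ℤ) :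
    elemD0 p (a, b) = if p.2 = b then
      (if p.1 ≤ a ∧ a ≤ 1 - p.1 + 2 * p.2 then 1 else 0)
        - (if 1 - p.1 + 2 * p.2 < a ∧ a < p.1 then 1 else 0) else 0 := by
  obtain ⟨x, y⟩ := p
  have h (i : ℤ) : ((x + i, y) = (a, b)) ↔ (i = a - x ∧ y = b) := by
    rw [Prod.mk.injEq]; lia
  simp only [elemD0, Finsupp.sub_apply, Finsupp.finsetSum_apply, Finsupp.single_apply, h]
  by_cases hy : y = b
  · simp only [hy, and_true, Finset.sum_ite_eq', Finset.mem_Icc, if_true]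
    congr 2 <;> apply propext <;> lia
  · simp [hy]

theorem elemD1_apply (p : ℤ × ℤ) (a b : ℤ) :
    elemD1 p (a, b) = if p.1 = a then
      (if p.2 ≤ b ∧ b ≤ 2 * p.1 - p.2 then 1 else 0)
        - (if 2 * p.1 - p.2 < b ∧ b < p.2 then 1 else 0) else 0 := by
  obtain ⟨x, y⟩ := p
  have h (i : ℤ) : ((x, y + i) = (a, b)) ↔ (i = b - y ∧ x = a) := by
    rw [Prod.mk.injEq]; lia
  simp only [elemD1, Finsupp.sub_apply, Finsupp.finsetSum_apply, Finsupp.single_apply, h]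
  by_cases hx : x = a
  · simp only [hx, and_true, Finset.sum_ite_eq', Finset.mem_Icc, if_true]
    congr 2 <;> apply propext <;> lia
  · simp [hx]

theorem demD0_apply_sub (mu : (ℤ × ℤ) →₀ ℤ) (a b : ℤ) :
    demD0 mu (a, b) - demD0 mu (a - 1, b) = mu (a, b) - mu (2 - a + 2 * b, b) := by
  induction mu using Finsupp.induction_linear with
  | zero => simp [demD0]
  | add f g hf hg =>
    have h : demD0 (f + g) = demD0 f + demD0 g :=
      Finsupp.sum_add_index' (by simp) (by simp [add_smul])
    simp only [h, Finsupp.add_apply]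
    linarith
  | single p c =>
    obtain ⟨x, y⟩ := p
    have h : demD0 (Finsupp.single (x, y) c) = c • elemD0 (x, y) :=
      Finsupp.sum_single_index (by simp)
    simp only [h, Finsupp.smul_apply, elemD0_apply, Finsupp.single_apply, smul_eq_mul,
      Prod.mk.injEq]
    split_ifs <;> lia

theorem demD1_apply_sub (mu : (ℤ × ℤ) →₀ ℤ) (a b : ℤ) :
    demD1 mu (a, b) - demD1 mu (a, b - 1) = mu (a, b) - mu (a, 2 * a - b + 1) := by
  induction mu using Finsupp.induction_linear with
  | zero => simp [demD1]
  | add f g hf hg =>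
    have h : demD1 (f + g) = demD1 f + demD1 g :=
      Finsupp.sum_add_index' (by simp) (by simp [add_smul])
    simp only [h, Finsupp.add_apply]
    linarith
  | single p c =>
    obtain ⟨x, y⟩ := p
    have h : demD1 (Finsupp.single (x, y) c) = c • elemD1 (x, y) :=
      Finsupp.sum_single_index (by simp)
    simp only [h, Finsupp.smul_apply, elemD1_apply, Finsupp.single_apply, smul_eq_mul,
      Prod.mk.injEq]
    split_ifs <;> lia

/-- Two functions on `ℤ` with equal differences agree if the first is finitely supported and the
second vanishes near `-∞`. -/
theorem eq_of_sub_eq_sub {f g : ℤ → ℤ} (hf : f.support.Finite) {l : ℤ}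
    (hg : ∀ x < l, g x = 0) (h : ∀ x, f x - f (x - 1) = g x - g (x - 1)) : f = g := by
  obtain ⟨m, hm⟩ := hf.bddBelow
  have hf0 : ∀ x < m, f x = 0 := fun x hx => by
    by_contra hne
    exact (hm hne).not_gt hx
  have key (n : ℕ) : f (min l m - 1 + n) = g (min l m - 1 + n) := by
    induction n with
    | zero => rw [hf0 _ (by grind), hg _ (by grind)]
    | succ n ih =>
      have := h (min l m - 1 + (n + 1 : ℕ))
      rw [show min l m - 1 + ((n + 1 : ℕ) : ℤ) - 1 = min l m - 1 + n by push_cast; ring] at this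
      lia
  funext x
  rcases lt_or_ge x (min l m) with hx | hx
  · rw [hf0 _ (by grind), hg _ (by grind)]
  · have := key (x - (min l m - 1)).toNat
    rwa [Int.toNat_of_nonneg (by lia), add_sub_cancel] at this

theorem Finsupp.finite_support_comp {α β M : Type*} [Zero M] (mu : β →₀ M) {e : α → β}
    (he : Function.Injective e) : (Function.support fun x => mu (e x)).Finite :=
  mu.hasFiniteSupport.preimage he.injOn

theorem demD0_apply_eq_gaussCoeff {mu : (ℤ × ℤ) →₀ ℤ} {m : ℕ}
    (h : ∀ a b, mu (a, b) = gaussCoeff (2 * m) (m + (a - b)) (a - (a - b) ^ 2)) (a b : ℤ) :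
    demD0 mu (a, b) = gaussCoeff (2 * m + 1) (m + (a - b)) (a - (a - b) ^ 2) := by
  refine congrFun (eq_of_sub_eq_sub (f := fun x => demD0 mu (x, b))
    (g := fun x => gaussCoeff (2 * m + 1) (m + (x - b)) (x - (x - b) ^ 2)) (l := b - m)
    (Finsupp.finite_support_comp _ (Prod.mk_left_injective b))
    (fun x hx => gaussCoeff_eq_zero_of_neg _ (by lia) _) fun x => ?_) a
  rw [demD0_apply_sub, h, h, gaussCoeff_succ, gaussCoeff_succ',
    ← gaussCoeff_symm _ (m + (2 - x + 2 * b - b))]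
  push_cast
  ring_nf

theorem demD1_apply_eq_gaussCoeff {mu : (ℤ × ℤ) →₀ ℤ} {m : ℕ}
    (h : ∀ a b, mu (a, b) = gaussCoeff (2 * m + 1) (m + (a - b)) (a - (a - b) ^ 2)) (a b : ℤ) :
    demD1 mu (a, b) = gaussCoeff (2 * m + 1 + 1) (m + 1 + (a - b)) (a - (a - b) ^ 2) := by
  refine congrFun (eq_of_sub_eq_sub (f := fun y => demD1 mu (a, y))
    (g := fun y => gaussCoeff (2 * m + 1 + 1) (m + 1 + (a - y)) (a - (a - y) ^ 2)) (l := a - m - 1)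
    (Finsupp.finite_support_comp _ (Prod.mk_right_injective a))
    (fun y hy => gaussCoeff_eq_zero_of_lt _ (by push_cast; lia) _) fun y => ?_) b
  rw [demD1_apply_sub, h, h, gaussCoeff_succ' (2 * m + 1), gaussCoeff_succ (2 * m + 1),
    ← gaussCoeff_symm _ (m + (a - (2 * a - y + 1)))]
  push_cast
  ring_nf

theorem demMu_two_mul_add_one (m : ℕ) : demMu (2 * m + 1) = demD0 (demMu (2 * m)) := by
  simp [demMu]

theorem demMu_two_mul_add_two (m : ℕ) : demMu (2 * m + 2) = demD1 (demMu (2 * m + 1)) := by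
  simp [demMu]

theorem demMu_two_mul_apply (m : ℕ) (a b : ℤ) :
    demMu (2 * m) (a, b) = gaussCoeff (2 * m) (m + (a - b)) (a - (a - b) ^ 2) := by
  induction m generalizing a b with
  | zero =>
    simp only [demMu, gaussCoeff, Finsupp.single_apply, Prod.mk.injEq]
    congr 1
    grind
  | succ m ih =>
    rw [mul_add_one, demMu_two_mul_add_two, demMu_two_mul_add_one,
      demD1_apply_eq_gaussCoeff (demD0_apply_eq_gaussCoeff ih)]
    push_cast
    rfl

theorem demMu_two_mul_add_one_apply (m : ℕ) (a b : ℤ) :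
    demMu (2 * m + 1) (a, b) = gaussCoeff (2 * m + 1) (m + (a - b)) (a - (a - b) ^ 2) := by
  rw [demMu_two_mul_add_one, demD0_apply_eq_gaussCoeff (demMu_two_mul_apply m)]

/-- Palindromicity of the string functions: `μ_N(a,b) = μ_N(a+S, b+S)`, where
`S = N²/4 + (a-b)² - 2a` for even `N` and `S = (N²-1)/4 + (a-b)² - (a-b) - 2b`
for odd `N`. -/
theorem string_palindromic (N : ℕ) (a b S : ℤ)
    (hS : S = if Even N then (N : ℤ) ^ 2 / 4 + (a - b) ^ 2 - 2 * a
      else ((N : ℤ) ^ 2 - 1) / 4 + (a - b) ^ 2 - (a - b) - 2 * b) :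
    (demMu N) (a, b) = (demMu N) (a + S, b + S) := by
  obtain ⟨m, rfl | rfl⟩ := N.even_or_odd'
  · have hS' : S = (m : ℤ) ^ 2 + (a - b) ^ 2 - 2 * a := by
      rw [hS, if_pos (even_two_mul m),
        show ((2 * m : ℕ) : ℤ) ^ 2 = 4 * (m : ℤ) ^ 2 by push_cast; ring,
        Int.mul_ediv_cancel_left _ four_ne_zero]
    rw [demMu_two_mul_apply, demMu_two_mul_apply, ← gaussCoeff_palindromic, hS']
    push_cast
    ring_nf
  · have hS' : S = (m : ℤ) ^ 2 + m + (a - b) ^ 2 - (a - b) - 2 * b := by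
      rw [hS, if_neg (by simp),
        show ((2 * m + 1 : ℕ) : ℤ) ^ 2 - 1 = 4 * ((m : ℤ) ^ 2 + m) by push_cast; ring,
        Int.mul_ediv_cancel_left _ four_ne_zero]
    rw [demMu_two_mul_add_one_apply, demMu_two_mul_add_one_apply, ← gaussCoeff_palindromic, hS']
    push_cast
    ring_nf
end

section
/- For every even N ≥ 0, Cov_{μ_N}((a−b)² − 2a, (a−b)²) = 0. -/
/-- The pairing `∑ μ(a,b) f(a,b)`, as a linear functional of `f`. -/
noncomputable def pairing (μ : (ℤ × ℤ) →₀ ℤ) : (ℤ × ℤ → ℚ) →ₗ[ℚ] ℚ :=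
  ∑ p ∈ μ.support, (μ p : ℚ) • LinearMap.proj p

theorem pairing_apply (μ : (ℤ × ℤ) →₀ ℤ) (f : ℤ × ℤ → ℚ) :
    pairing μ f = μ.sum fun p c => (c : ℚ) * f p := by
  simp [pairing, Finsupp.sum]

theorem pairing_eq_linearCombination (μ : (ℤ × ℤ) →₀ ℤ) (f : ℤ × ℤ → ℚ) :
    pairing μ f = Finsupp.linearCombination ℤ f μ := by
  simp [pairing_apply, Finsupp.linearCombination_apply]

theorem pairing_single (p : ℤ × ℤ) (f : ℤ × ℤ → ℚ) :
    pairing (Finsupp.single p 1) f = f p := by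
  simp [pairing_eq_linearCombination]

theorem sum_Icc_sub_telescope (G : ℤ → ℚ) {m n : ℤ} (h : m ≤ n + 1) :
    ∑ i ∈ Finset.Icc m n, (G (i + 1) - G i) = G (n + 1) - G m := by
  obtain ⟨k, hk⟩ := Int.eq_ofNat_of_zero_le (sub_nonneg.2 h)
  obtain rfl : n = m + k - 1 := by lia
  clear h hk
  induction k with
  | zero => simp
  | succ k ih =>
    have hI : Finset.Icc m (m + (k + 1 : ℕ) - 1) =
        insert (m + (k : ℤ)) (Finset.Icc m (m + k - 1)) := by
      ext x
      simp only [Finset.mem_Icc, Finset.mem_insert]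
      lia
    rw [hI, Finset.sum_insert (by simp), ih]
    simp only [sub_add_cancel, Nat.cast_add, Nat.cast_one, add_assoc]
    ring

theorem signed_sum_telescope (G : ℤ → ℚ) (n : ℤ) :
    ∑ i ∈ Finset.Icc 0 n, (G (i + 1) - G i) -
      ∑ i ∈ Finset.Icc (n + 1) (-1), (G (i + 1) - G i) = G (n + 1) - G 0 := by
  rcases le_total 0 (n + 1) with h | h
  · rw [sum_Icc_sub_telescope G h, Finset.Icc_eq_empty (by lia)]
    simp
  · rw [Finset.Icc_eq_empty (a := (0 : ℤ)) (b := n) (by lia),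
      sum_Icc_sub_telescope G (by lia)]
    simp

theorem pairing_sum_smul (μ : (ℤ × ℤ) →₀ ℤ) (E : ℤ × ℤ → (ℤ × ℤ) →₀ ℤ) (f : ℤ × ℤ → ℚ) :
    pairing (μ.sum fun p c => c • E p) f = pairing μ fun p => pairing (E p) f := by
  simp only [pairing_eq_linearCombination, map_finsuppSum, map_smul]
  rw [Finsupp.linearCombination_apply]

/-- Pairing with `D₀ μ`, computed from an antidifference of the test function in the direction
of the first coordinate. -/
theorem pairing_demD0 (μ : (ℤ × ℤ) →₀ ℤ) {f : ℤ × ℤ → ℚ} {F : ℚ → ℚ → ℚ}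
    (hF : ∀ a b : ℤ, F (a + 1) b - F a b = f (a, b)) :
    pairing (demD0 μ) f = pairing μ fun p => F (2 - p.1 + 2 * p.2) p.2 - F p.1 p.2 := by
  rw [demD0, pairing_sum_smul]
  congr 1
  ext ⟨a, b⟩
  have h := signed_sum_telescope (fun i => F ((a + i : ℤ) : ℚ) b) (1 - 2 * a + 2 * b)
  have hf (i : ℤ) : F ((a + (i + 1) : ℤ) : ℚ) b - F ((a + i : ℤ) : ℚ) b = f (a + i, b) := by
    rw [← hF]
    push_cast
    rw [add_assoc]
  simp only [hf] at h
  simp only [pairing_eq_linearCombination, elemD0, map_sub, map_sum,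
    Finsupp.linearCombination_single, one_smul]
  rw [h]
  push_cast
  congr 2 <;> ring

/-- Pairing with `D₁ μ`, computed from an antidifference of the test function in the direction
of the second coordinate. -/
theorem pairing_demD1 (μ : (ℤ × ℤ) →₀ ℤ) {f : ℤ × ℤ → ℚ} {F : ℚ → ℚ → ℚ}
    (hF : ∀ a b : ℤ, F a (b + 1) - F a b = f (a, b)) :
    pairing (demD1 μ) f = pairing μ fun p => F p.1 (2 * p.1 - p.2 + 1) - F p.1 p.2 := by
  rw [demD1, pairing_sum_smul]
  congr 1
  ext ⟨a, b⟩
  have h := signed_sum_telescope (fun i => F a ((b + i : ℤ) : ℚ)) (2 * a - 2 * b)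
  have hf (i : ℤ) : F a ((b + (i + 1) : ℤ) : ℚ) - F a ((b + i : ℤ) : ℚ) = f (a, b + i) := by
    rw [← hF]
    push_cast
    rw [add_assoc]
  simp only [hf] at h
  simp only [pairing_eq_linearCombination, elemD1, map_sub, map_sum,
    Finsupp.linearCombination_single, one_smul]
  rw [h]
  push_cast
  congr 2 <;> ring

theorem pairing_demD1_demD0 (μ : (ℤ × ℤ) →₀ ℤ) {f K : ℤ × ℤ → ℚ} {F G : ℚ → ℚ → ℚ}
    (hF : ∀ a b : ℤ, F a (b + 1) - F a b = f (a, b))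
    (hG : ∀ a b : ℤ, G (a + 1) b - G a b = F a (2 * a - b + 1) - F a b)
    (hK : ∀ a b : ℤ, K (a, b) = G (2 - a + 2 * b) b - G a b) :
    pairing (demD1 (demD0 μ)) f = pairing μ K := by
  rw [pairing_demD1 _ hF, pairing_demD0 _ hG]
  congr 1
  ext ⟨a, b⟩
  exact (hK a b).symm

/-- The test function `a ^ i * (a - b) ^ j`. -/
def monomialFn (i j : ℕ) (p : ℤ × ℤ) : ℚ :=
  (p.1 : ℚ) ^ i * ((p.1 : ℚ) - p.2) ^ j

/-- The mixed moment `∑ μ(a,b) a ^ i (a - b) ^ j`. -/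
noncomputable def moment (μ : (ℤ × ℤ) →₀ ℤ) (i j : ℕ) : ℚ :=
  pairing μ (monomialFn i j)

/-- The distribution `D₁ μ` is symmetric under `(a, b) ↦ (a, 2a - b)`. -/
theorem pairing_demD1_comp_reflection (μ : (ℤ × ℤ) →₀ ℤ) (f : ℤ × ℤ → ℚ) :
    pairing (demD1 μ) (fun p => f (p.1, 2 * p.1 - p.2)) = pairing (demD1 μ) f := by
  simp only [demD1, pairing_sum_smul]
  congr 1
  ext ⟨a, b⟩
  simp only [pairing_eq_linearCombination, elemD1, map_sub, map_sum,
    Finsupp.linearCombination_single, one_smul]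
  congr 1
  all_goals
    refine Finset.sum_bij' (fun i _ => 2 * a - 2 * b - i) (fun i _ => 2 * a - 2 * b - i)
      ?_ ?_ ?_ ?_ ?_
    · intro i hi
      simp only [Finset.mem_Icc] at hi ⊢
      lia
    · intro i hi
      simp only [Finset.mem_Icc] at hi ⊢
      lia
    · intro i _
      ring
    · intro i _
      ring
    · intro i _
      congr 2
      ring

/-- Moments of `D₁ μ` of odd degree in `a - b` vanish. -/
theorem moment_demD1_of_odd (μ : (ℤ × ℤ) →₀ ℤ) (i : ℕ) {j : ℕ} (hj : Odd j) :
    moment (demD1 μ) i j = 0 := by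
  have hneg : (fun p : ℤ × ℤ => monomialFn i j (p.1, 2 * p.1 - p.2)) = -monomialFn i j := by
    ext p
    simp only [monomialFn, Pi.neg_apply]
    push_cast
    rw [show (p.1 : ℚ) - (2 * p.1 - p.2) = -(p.1 - p.2) by ring, hj.neg_pow]
    ring
  have h := pairing_demD1_comp_reflection μ (monomialFn i j)
  rw [hneg, map_neg] at h
  rw [moment]
  linarith

theorem moment_demD1_demD0_0_0 (μ : (ℤ × ℤ) →₀ ℤ) :
    moment (demD1 (demD0 μ)) 0 0 =
      4 * moment μ 0 0 - 4 * moment μ 0 1 := by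
  rw [moment, pairing_demD1_demD0 μ
    (F := fun a b => -(a - b))
    (G := fun a b => (a - b) ^ 2)
    (K := (4 : ℚ) • monomialFn 0 0 - (4 : ℚ) • monomialFn 0 1)]
  · simp [moment]
  all_goals
    intro a b
    simp [monomialFn]
    try ring

theorem moment_demD1_demD0_0_2 (μ : (ℤ × ℤ) →₀ ℤ) :
    moment (demD1 (demD0 μ)) 0 2 =
      2 * moment μ 0 0 - (14 / 3) * moment μ 0 1 + 4 * moment μ 0 2 - (4 / 3) * moment μ 0 3 := by
  rw [moment, pairing_demD1_demD0 μ
    (F := fun a b => (-1 / 6) * (a - b) - (1 / 2) * (a - b) ^ 2 - (1 / 3) * (a - b) ^ 3)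
    (G := fun a b => (-1 / 6) * (a - b) ^ 2 + (1 / 6) * (a - b) ^ 4)
    (K := (2 : ℚ) • monomialFn 0 0 - (14 / 3 : ℚ) • monomialFn 0 1 + (4 : ℚ) • monomialFn 0 2 -
      (4 / 3 : ℚ) • monomialFn 0 3)]
  · simp [moment]
  all_goals
    intro a b
    simp [monomialFn]
    try ring

theorem moment_demD1_demD0_0_4 (μ : (ℤ × ℤ) →₀ ℤ) :
    moment (demD1 (demD0 μ)) 0 4 =
      2 * moment μ 0 0 - (118 / 15) * moment μ 0 1 + 12 * moment μ 0 2 -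
      (28 / 3) * moment μ 0 3 + 4 * moment μ 0 4 - (4 / 5) * moment μ 0 5 := by
  rw [moment, pairing_demD1_demD0 μ
    (F := fun a b => (1 / 30) * (a - b) - (1 / 3) * (a - b) ^ 3 - (1 / 2) * (a - b) ^ 4 -
      (1 / 5) * (a - b) ^ 5)
    (G := fun a b => (1 / 10) * (a - b) ^ 2 - (1 / 6) * (a - b) ^ 4 + (1 / 15) * (a - b) ^ 6)
    (K := (2 : ℚ) • monomialFn 0 0 - (118 / 15 : ℚ) • monomialFn 0 1 +
      (12 : ℚ) • monomialFn 0 2 - (28 / 3 : ℚ) • monomialFn 0 3 + (4 : ℚ) • monomialFn 0 4 -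
      (4 / 5 : ℚ) • monomialFn 0 5)]
  · simp [moment]
  all_goals
    intro a b
    simp [monomialFn]
    try ring

theorem moment_demD1_demD0_1_0 (μ : (ℤ × ℤ) →₀ ℤ) :
    moment (demD1 (demD0 μ)) 1 0 =
      3 * moment μ 0 0 - (29 / 3) * moment μ 0 1 + 8 * moment μ 0 2 - (4 / 3) * moment μ 0 3 +
      4 * moment μ 1 0 - 4 * moment μ 1 1 := by
  rw [moment, pairing_demD1_demD0 μ
    (F := fun a b => -a * (a - b))
    (G := fun a b => (-1 / 6) * (a - b) - (1 / 2) * (a - b) ^ 2 + (2 / 3) * (a - b) ^ 3 +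
      b * (a - b) ^ 2)
    (K := (3 : ℚ) • monomialFn 0 0 - (29 / 3 : ℚ) • monomialFn 0 1 + (8 : ℚ) • monomialFn 0 2 -
      (4 / 3 : ℚ) • monomialFn 0 3 + (4 : ℚ) • monomialFn 1 0 - (4 : ℚ) • monomialFn 1 1)]
  · simp [moment]
  all_goals
    intro a b
    simp [monomialFn]
    try ring

theorem moment_demD1_demD0_1_2 (μ : (ℤ × ℤ) →₀ ℤ) :
    moment (demD1 (demD0 μ)) 1 2 =
      2 * moment μ 0 0 - (42 / 5) * moment μ 0 1 + (37 / 3) * moment μ 0 2 -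
      (25 / 3) * moment μ 0 3 + (8 / 3) * moment μ 0 4 - (4 / 15) * moment μ 0 5 +
      2 * moment μ 1 0 - (14 / 3) * moment μ 1 1 + 4 * moment μ 1 2 - (4 / 3) * moment μ 1 3 := by
  rw [moment, pairing_demD1_demD0 μ
    (F := fun a b => (-1 / 6) * a * (a - b) - (1 / 2) * a * (a - b) ^ 2 - (1 / 3) * a * (a - b) ^ 3)
    (G := fun a b => (1 / 30) * (a - b) + (1 / 12) * (a - b) ^ 2 - (1 / 6) * (a - b) ^ 3 -
      (1 / 12) * (a - b) ^ 4 + (2 / 15) * (a - b) ^ 5 - (1 / 6) * b * (a - b) ^ 2 +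
      (1 / 6) * b * (a - b) ^ 4)
    (K := (2 : ℚ) • monomialFn 0 0 - (42 / 5 : ℚ) • monomialFn 0 1 +
      (37 / 3 : ℚ) • monomialFn 0 2 - (25 / 3 : ℚ) • monomialFn 0 3 +
      (8 / 3 : ℚ) • monomialFn 0 4 - (4 / 15 : ℚ) • monomialFn 0 5 + (2 : ℚ) • monomialFn 1 0 -
      (14 / 3 : ℚ) • monomialFn 1 1 + (4 : ℚ) • monomialFn 1 2 - (4 / 3 : ℚ) • monomialFn 1 3)]
  · simp [moment]
  all_goals
    intro a b
    simp [monomialFn]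
    try ring

theorem demMu_two_mul_succ (n : ℕ) :
    demMu (2 * (n + 1)) = demD1 (demD0 (demMu (2 * n))) := by
  simp [mul_add, demMu]

theorem moment_demMu_two_mul_of_odd (n i : ℕ) {j : ℕ} (hj : Odd j) :
    moment (demMu (2 * n)) i j = 0 := by
  cases n with
  | zero => simp [demMu, moment, pairing_single, monomialFn, hj.pos.ne']
  | succ n => rw [demMu_two_mul_succ, moment_demD1_of_odd _ _ hj]

theorem moments_demMu_two_mul (n : ℕ) :
    moment (demMu (2 * n)) 0 0 = 4 ^ n ∧
    moment (demMu (2 * n)) 0 2 = 4 ^ n * (n / 2) ∧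
    moment (demMu (2 * n)) 0 4 = 4 ^ n * (3 * n ^ 2 / 4 - n / 4) ∧
    moment (demMu (2 * n)) 1 0 = 4 ^ n * (n ^ 2 / 2 + n / 4) ∧
    moment (demMu (2 * n)) 1 2 = 4 ^ n * (n ^ 3 / 4 + 3 * n ^ 2 / 8 - n / 8) := by
  induction n with
  | zero => simp [demMu, moment, pairing_single, monomialFn]
  | succ n ih =>
    obtain ⟨h00, h02, h04, h10, h12⟩ := ih
    have h01 := moment_demMu_two_mul_of_odd n 0 (j := 1) (by decide)
    have h03 := moment_demMu_two_mul_of_odd n 0 (j := 3) (by decide)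
    have h05 := moment_demMu_two_mul_of_odd n 0 (j := 5) (by decide)
    have h11 := moment_demMu_two_mul_of_odd n 1 (j := 1) (by decide)
    have h13 := moment_demMu_two_mul_of_odd n 1 (j := 3) (by decide)
    rw [demMu_two_mul_succ, moment_demD1_demD0_0_0, moment_demD1_demD0_0_2,
      moment_demD1_demD0_0_4, moment_demD1_demD0_1_0, moment_demD1_demD0_1_2,
      h00, h01, h02, h03, h04, h05, h10, h11, h12, h13]
    push_cast
    refine ⟨?_, ?_, ?_, ?_, ?_⟩ <;> ring

/-- For even `N`, `Cov_{μ_N}((a-b)² - 2a, (a-b)²) = 0`. -/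
theorem even_stretched_covariance_zero (N : ℕ) (hN : Even N) :
    covar (demMu N)
      (fun p => ((p.1 : ℚ) - (p.2 : ℚ)) ^ 2 - 2 * (p.1 : ℚ))
      (fun p => ((p.1 : ℚ) - (p.2 : ℚ)) ^ 2) = 0 := by
  obtain ⟨n, rfl⟩ := hN.exists_two_nsmul
  rw [smul_eq_mul]
  obtain ⟨h00, h02, h04, h10, h12⟩ := moments_demMu_two_mul n
  have hmass : totalMass (demMu (2 * n)) = 4 ^ n := by
    rw [← h00, moment, pairing_apply]
    simp [totalMass, monomialFn]
  have hfg : (fun p : ℤ × ℤ => (((p.1 : ℚ) - p.2) ^ 2 - 2 * p.1) * ((p.1 : ℚ) - p.2) ^ 2) =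
      monomialFn 0 4 - (2 : ℚ) • monomialFn 1 2 := by
    ext p
    simp [monomialFn]
    ring
  have hf : (fun p : ℤ × ℤ => ((p.1 : ℚ) - p.2) ^ 2 - 2 * p.1) =
      monomialFn 0 2 - (2 : ℚ) • monomialFn 1 0 := by
    ext p
    simp [monomialFn]
  have hg : (fun p : ℤ × ℤ => ((p.1 : ℚ) - p.2) ^ 2) = monomialFn 0 2 := by
    ext p
    simp [monomialFn]
  simp only [moment] at h02 h04 h10 h12
  simp only [covar, expVal, ← pairing_apply, hmass]
  rw [hfg, hf, hg]
  simp only [map_sub, map_smul, smul_eq_mul, h02, h04, h10, h12]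
  field_simp
  ring
end

section
/- (Recurrence relations.) For every odd N ≥ 1: E_{μ_{N+1}}[a²] = E_{μ_N}[a²] + N²(N+3)/16. For every even N ≥ 0: E_{μ_{N+1}}[b²] = E_{μ_N}[b²] + N(N²+3N−2)/16. -/
/-- The signed sum `∑_{i=0}^{n} f i` over the integers. -/
noncomputable def signedSum (f : ℤ → ℚ) (n : ℤ) : ℚ :=
  ∑ i ∈ Finset.Icc 0 n, f i - ∑ i ∈ Finset.Icc (n + 1) (-1), f i

lemma signedSum_add_one (f : ℤ → ℚ) (n : ℤ) :
    signedSum f (n + 1) = signedSum f n + f (n + 1) := by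
  unfold signedSum
  rcases le_or_gt 0 (n + 1) with h | h
  · have h₁ : Finset.Icc 0 (n + 1) = insert (n + 1) (Finset.Icc 0 n) := by
      ext x; simp only [Finset.mem_Icc, Finset.mem_insert]; omega
    rw [h₁, Finset.sum_insert (by simp), Finset.Icc_eq_empty (by omega : ¬ n + 1 + 1 ≤ -1),
      Finset.Icc_eq_empty (by omega : ¬ n + 1 ≤ -1)]
    simp only [Finset.sum_empty]
    ring
  · have h₁ : Finset.Icc (n + 1) (-1) = insert (n + 1) (Finset.Icc (n + 1 + 1) (-1)) := by
      ext x; simp only [Finset.mem_Icc, Finset.mem_insert]; omega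
    rw [h₁, Finset.sum_insert (by simp), Finset.Icc_eq_empty (by omega : ¬ 0 ≤ n + 1),
      Finset.Icc_eq_empty (by omega : ¬ 0 ≤ n)]
    simp only [Finset.sum_empty]
    ring

lemma signedSum_neg_one (f : ℤ → ℚ) : signedSum f (-1) = 0 := by
  simp [signedSum]

lemma signedSum_sub_succ (h : ℤ → ℚ) (n : ℤ) :
    signedSum (fun i => h i - h (i + 1)) n = h 0 - h (n + 1) := by
  have key : ∀ m : ℤ, signedSum (fun i => h i - h (i + 1)) (m - 1) = h 0 - h m := by
    intro m
    induction m using Int.induction_on with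
    | zero => simpa using signedSum_neg_one _
    | succ i ih =>
      have := signedSum_add_one (fun i => h i - h (i + 1)) ((i : ℤ) - 1)
      rw [sub_add_cancel, ih] at this
      rw [add_sub_cancel_right, this]
      ring
    | pred i ih =>
      have := signedSum_add_one (fun i => h i - h (i + 1)) (-(i : ℤ) - 1 - 1)
      rw [sub_add_cancel, ih, sub_add_cancel] at this
      linarith
  simpa using key (n + 1)

lemma exists_sub_succ_eq (f : ℤ → ℚ) : ∃ h : ℤ → ℚ, ∀ i, h i - h (i + 1) = f i := by
  refine ⟨fun n => -signedSum f (n - 1), fun i => ?_⟩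
  have := signedSum_add_one f (i - 1)
  rw [sub_add_cancel] at this
  simp only [add_sub_cancel_right, this]
  ring

/-- Integration of `f` against a finitely supported signed measure. -/
noncomputable def integral (f : ℤ × ℤ → ℚ) : ((ℤ × ℤ) →₀ ℤ) →+ ℚ :=
  Finsupp.liftAddHom fun p => (AddMonoidHom.mulRight (f p)).comp (Int.castAddHom ℚ)

lemma integral_apply (f : ℤ × ℤ → ℚ) (mu : (ℤ × ℤ) →₀ ℤ) :
    integral f mu = mu.sum fun p c => (c : ℚ) * f p := rfl

lemma integral_single (f : ℤ × ℤ → ℚ) (p : ℤ × ℤ) (c : ℤ) :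
    integral f (Finsupp.single p c) = c * f p := by
  simp [integral_apply]

lemma expVal_eq (mu : (ℤ × ℤ) →₀ ℤ) (f : ℤ × ℤ → ℚ) :
    expVal mu f = integral f mu / integral (fun _ => 1) mu := by
  simp [expVal, totalMass, integral_apply]

lemma integral_demD0 (g : ℤ × ℤ → ℚ) (mu : (ℤ × ℤ) →₀ ℤ) :
    integral (fun p => g p - g (p.1 + 1, p.2)) (demD0 mu) =
      integral (fun p => g p - g (2 - p.1 + 2 * p.2, p.2)) mu := by
  rw [demD0, map_finsuppSum, integral_apply]
  refine Finsupp.sum_congr fun p _ => ?_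
  have h := signedSum_sub_succ (fun i => g (p.1 + i, p.2)) (1 - 2 * p.1 + 2 * p.2)
  rw [map_zsmul, zsmul_eq_mul, elemD0, map_sub, map_sum, map_sum]
  simp only [integral_single, Int.cast_one, one_mul]
  simp only [signedSum, ← add_assoc] at h
  rw [h]
  congr 4 <;> ring_nf

lemma integral_demD1 (g : ℤ × ℤ → ℚ) (mu : (ℤ × ℤ) →₀ ℤ) :
    integral (fun p => g p - g (p.1, p.2 + 1)) (demD1 mu) =
      integral (fun p => g p - g (p.1, 2 * p.1 - p.2 + 1)) mu := by
  rw [demD1, map_finsuppSum, integral_apply]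
  refine Finsupp.sum_congr fun p _ => ?_
  have h := signedSum_sub_succ (fun i => g (p.1, p.2 + i)) (2 * p.1 - 2 * p.2)
  rw [map_zsmul, zsmul_eq_mul, elemD1, map_sub, map_sum, map_sum]
  simp only [integral_single, Int.cast_one, one_mul]
  simp only [signedSum, ← add_assoc] at h
  rw [h]
  congr 4 <;> ring_nf

/-- The sum of `g k i` over all binary words of length `N`, where `k` is the number of ones
and `i` the number of inversions (the coefficients of the `q`-binomials `[N choose k]`). -/
def wordSum : ℕ → (ℤ → ℤ → ℚ) → ℚ
  | 0, g => g 0 0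
  | N + 1, g => wordSum N fun k i => g k (i + k) + g (k + 1) i

lemma wordSum_succ (N : ℕ) (g : ℤ → ℤ → ℚ) :
    wordSum (N + 1) g = wordSum N fun k i => g k (i + k) + g (k + 1) i := rfl

lemma wordSum_add (N : ℕ) (f g : ℤ → ℤ → ℚ) :
    wordSum N (fun k i => f k i + g k i) = wordSum N f + wordSum N g := by
  induction N generalizing f g with
  | zero => rfl
  | succ N ih =>
    simp only [wordSum, ← ih]
    congr! 3
    ring

lemma wordSum_sub (N : ℕ) (f g : ℤ → ℤ → ℚ) :
    wordSum N (fun k i => f k i - g k i) = wordSum N f - wordSum N g := by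
  rw [eq_sub_iff_add_eq, ← wordSum_add]
  simp

/-- Splitting off the first letter of a word instead of the last one. -/
lemma wordSum_succ' (N : ℕ) (g : ℤ → ℤ → ℚ) :
    wordSum (N + 1) g = wordSum N fun k i => g k i + g (k + 1) (i + (N - k)) := by
  induction N generalizing g with
  | zero => simp [wordSum]
  | succ N ih =>
    rw [wordSum, ih, wordSum]
    congr! 3 with k i
    push_cast
    ring_nf

/-- The symmetry `[N choose k] = [N choose N - k]`. -/
lemma wordSum_symm (N : ℕ) (g : ℤ → ℤ → ℚ) :
    wordSum N (fun k i => g (N - k) i) = wordSum N g := by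
  induction N generalizing g with
  | zero => simp [wordSum]
  | succ N ih =>
    rw [wordSum_succ' N g, ← ih, wordSum]
    congr! 3 with k i
    push_cast
    ring_nf

/-- The point with `a - b = m` and `a = m² + i`. -/
def weightPt (m i : ℤ) : ℤ × ℤ := (m ^ 2 + i, m ^ 2 + i - m)

lemma integral_demD1_of_wordSum {n : ℕ} {mu : (ℤ × ℤ) →₀ ℤ}
    (hmu : ∀ f, integral f mu = wordSum (2 * n + 1) fun k i => f (weightPt (k - n) i))
    (f : ℤ × ℤ → ℚ) :
    integral f (demD1 mu) =
      wordSum (2 * n + 1 + 1) fun k i => f (weightPt (k - (n + 1)) i) := by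
  choose h hh using fun a => exists_sub_succ_eq fun b => f (a, b)
  obtain rfl : f = fun p => h p.1 p.2 - h p.1 (p.2 + 1) := funext fun p => (hh p.1 p.2).symm
  have hd := integral_demD1 (fun p => h p.1 p.2) mu
  dsimp only at hd
  rw [hd, hmu, wordSum_sub, wordSum_sub, wordSum_succ (2 * n + 1), wordSum_succ' (2 * n + 1),
    ← wordSum_symm _ fun k i => h (weightPt (k - n) i).1
      (2 * (weightPt (k - n) i).1 - (weightPt (k - n) i).2 + 1)]
  simp only [← wordSum_sub, weightPt]
  congr 1
  funext k i
  push_cast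
  ring_nf

lemma integral_demD0_of_wordSum {n : ℕ} {mu : (ℤ × ℤ) →₀ ℤ}
    (hmu : ∀ f, integral f mu = wordSum (2 * n) fun k i => f (weightPt (k - n) i))
    (f : ℤ × ℤ → ℚ) :
    integral f (demD0 mu) = wordSum (2 * n + 1) fun k i => f (weightPt (k - n) i) := by
  choose h hh using fun b => exists_sub_succ_eq fun a => f (a, b)
  obtain rfl : f = fun p => h p.2 p.1 - h p.2 (p.1 + 1) := funext fun p => (hh p.2 p.1).symm
  have hd := integral_demD0 (fun p => h p.2 p.1) mu
  dsimp only at hd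
  rw [hd, hmu, wordSum_sub, wordSum_sub, wordSum_succ', wordSum_succ,
    ← wordSum_symm _ fun k i => h (weightPt (k - n) i).2
      (2 - (weightPt (k - n) i).1 + 2 * (weightPt (k - n) i).2)]
  simp only [← wordSum_sub, weightPt]
  congr 1
  funext k i
  push_cast
  ring_nf

lemma demMu_odd_of_even (n : ℕ) : demMu (2 * n + 1) = demD0 (demMu (2 * n)) := by
  simp [demMu]

lemma demMu_even_of_odd (n : ℕ) : demMu (2 * n + 1 + 1) = demD1 (demMu (2 * n + 1)) := by
  rw [demMu, if_neg (by simp)]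

/-- The Demazure weight distribution in terms of `q`-binomials, for even index. -/
lemma integral_demMu_even (n : ℕ) (f : ℤ × ℤ → ℚ) :
    integral f (demMu (2 * n)) = wordSum (2 * n) fun k i => f (weightPt (k - n) i) := by
  induction n generalizing f with
  | zero => simp [demMu, integral_single, wordSum, weightPt]
  | succ n ih =>
    rw [show 2 * (n + 1) = 2 * n + 1 + 1 by ring, demMu_even_of_odd, demMu_odd_of_even,
      integral_demD1_of_wordSum (integral_demD0_of_wordSum ih)]
    push_cast
    rfl

/-- The Demazure weight distribution in terms of `q`-binomials, for odd index. -/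
lemma integral_demMu_odd (n : ℕ) (f : ℤ × ℤ → ℚ) :
    integral f (demMu (2 * n + 1)) = wordSum (2 * n + 1) fun k i => f (weightPt (k - n) i) := by
  rw [demMu_odd_of_even, integral_demD0_of_wordSum (integral_demMu_even n)]

/-- Joint moments of the number of ones and the number of inversions of a random binary word. -/
lemma wordSum_moments (N : ℕ) (c₀ c₁ c₂ c₃ c₄ d₀ d₁ d₂ e : ℚ) :
    wordSum N (fun k i => c₀ + c₁ * k + c₂ * k ^ 2 + c₃ * k ^ 3 + c₄ * k ^ 4
        + d₀ * i + d₁ * (i * k) + d₂ * (i * k ^ 2) + e * i ^ 2) =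
      2 ^ N * (c₀ + c₁ * (N / 2) + c₂ * (N * (N + 1) / 4) + c₃ * (N ^ 2 * (N + 3) / 8)
        + c₄ * (N * (N + 1) * (N ^ 2 + 5 * N - 2) / 16)
        + d₀ * (N * (N - 1) / 8) + d₁ * (N ^ 2 * (N - 1) / 16)
        + d₂ * (N * (N - 1) ^ 2 * (N + 2) / 32)
        + e * (N * (N - 1) * (3 * N ^ 2 + N + 10) / 192)) := by
  induction N generalizing c₀ c₁ c₂ c₃ c₄ d₀ d₁ d₂ e with
  | zero => simp [wordSum]
  | succ N ih =>
    have h := ih (2 * c₀ + c₁ + c₂ + c₃ + c₄) (2 * c₁ + 2 * c₂ + 3 * c₃ + 4 * c₄ + d₀)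
      (2 * c₂ + 3 * c₃ + 6 * c₄ + d₁ + e) (2 * c₃ + 4 * c₄ + d₂) (2 * c₄)
      (2 * d₀ + d₁ + d₂) (2 * d₁ + 2 * d₂ + 2 * e) (2 * d₂) (2 * e)
    rw [wordSum]
    refine Eq.trans (congrArg (wordSum N) ?_) (h.trans ?_)
    · funext k i
      push_cast
      ring
    · push_cast
      ring

lemma wordSum_one (N : ℕ) : wordSum N (fun _ _ => 1) = 2 ^ N := by
  simpa using wordSum_moments N 1 0 0 0 0 0 0 0 0

/-- Second moment of `(k - x)² + i - y (k - x)` for a random binary word; `y = 0` gives the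
coordinate `a` and `y = 1` the coordinate `b`. -/
lemma wordSum_sq (N : ℕ) (x y : ℚ) :
    wordSum N (fun k i => ((k - x) ^ 2 + i - y * (k - x)) ^ 2) / 2 ^ N =
      (x ^ 2 + y * x) ^ 2 - 2 * (x ^ 2 + y * x) * (2 * x + y) * (N / 2)
        + ((2 * x + y) ^ 2 + 2 * (x ^ 2 + y * x)) * (N * (N + 1) / 4)
        - 2 * (2 * x + y) * (N ^ 2 * (N + 3) / 8)
        + N * (N + 1) * (N ^ 2 + 5 * N - 2) / 16
        + 2 * (x ^ 2 + y * x) * (N * (N - 1) / 8) - 2 * (2 * x + y) * (N ^ 2 * (N - 1) / 16)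
        + 2 * (N * (N - 1) ^ 2 * (N + 2) / 32)
        + N * (N - 1) * (3 * N ^ 2 + N + 10) / 192 := by
  have h := wordSum_moments N ((x ^ 2 + y * x) ^ 2) (-2 * (x ^ 2 + y * x) * (2 * x + y))
    ((2 * x + y) ^ 2 + 2 * (x ^ 2 + y * x)) (-2 * (2 * x + y)) 1 (2 * (x ^ 2 + y * x))
    (-2 * (2 * x + y)) 2 1
  rw [div_eq_iff (by positivity)]
  refine Eq.trans (congrArg (wordSum N) ?_) (h.trans ?_)
  · funext k i
    ring
  · ring

/-- Recurrence relations: for odd `N`, `E_{μ_{N+1}}[a²] = E_{μ_N}[a²] + N²(N+3)/16`,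
and for even `N`, `E_{μ_{N+1}}[b²] = E_{μ_N}[b²] + N(N²+3N-2)/16`. -/
theorem recurrence_relations (N : ℕ) :
    (Odd N →
      expVal (demMu (N + 1)) (fun p => (p.1 : ℚ) ^ 2) =
        expVal (demMu N) (fun p => (p.1 : ℚ) ^ 2) + (N : ℚ) ^ 2 * ((N : ℚ) + 3) / 16) ∧
    (Even N →
      expVal (demMu (N + 1)) (fun p => (p.2 : ℚ) ^ 2) =
        expVal (demMu N) (fun p => (p.2 : ℚ) ^ 2)
          + (N : ℚ) * ((N : ℚ) ^ 2 + 3 * (N : ℚ) - 2) / 16) := by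
  have odd_eq (n : ℕ) (f : ℤ × ℤ → ℚ) : expVal (demMu (2 * n + 1)) f =
      wordSum (2 * n + 1) (fun k i => f (weightPt (k - n) i)) / 2 ^ (2 * n + 1) := by
    rw [expVal_eq, integral_demMu_odd, integral_demMu_odd, wordSum_one]
  have even_eq (n : ℕ) (f : ℤ × ℤ → ℚ) : expVal (demMu (2 * n)) f =
      wordSum (2 * n) (fun k i => f (weightPt (k - n) i)) / 2 ^ (2 * n) := by
    rw [expVal_eq, integral_demMu_even, integral_demMu_even, wordSum_one]
  constructor
  · rintro ⟨n, rfl⟩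
    have h₁ := wordSum_sq (2 * n + 1) n 0
    have h₂ := wordSum_sq (2 * (n + 1)) (n + 1) 0
    rw [odd_eq, show 2 * n + 1 + 1 = 2 * (n + 1) by ring, even_eq]
    simp only [weightPt]
    push_cast at h₁ h₂ ⊢
    simp only [zero_mul, sub_zero] at h₁ h₂
    rw [h₁, h₂]
    ring
  · rintro h
    obtain ⟨n, rfl⟩ := h.two_dvd
    have h₁ := wordSum_sq (2 * n) n 1
    have h₂ := wordSum_sq (2 * n + 1) n 1
    rw [odd_eq, even_eq]
    simp only [weightPt]
    push_cast at h₁ h₂ ⊢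
    simp only [one_mul] at h₁ h₂
    rw [h₁, h₂]
    ring
end
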